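/- Let R be a ring with identity. Then APOḠ(R) is a complete graph (every two distinct vertices are adjacent) if and only if at least one of the following holds: (i) (D(R))² = 0, i.e., xy = 0 for all one-sided zero-divisors x, y of R; (ii) R is isomorphic to a direct product of two division rings; (iii) R is a local ring whose unique maximal ideal m satisfies IPO(R) = {0, m, m², R}. -/

import Mathlib

open scoped Pointwise

/-- `I` is a left ideal of the ring `R`: an additive subgroup with `R·I ⊆ I`. -/
def IsLeftIdeal (R : Type*) [Ring R] (I : AddSubgroup R) : Prop :=
  ∀ r : R, ∀ x ∈ I, r * x ∈ I

/-- `I` is a right ideal of the ring `R`: an additive subgroup with `I·R ⊆ I`. -/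
def IsRightIdeal (R : Type*) [Ring R] (I : AddSubgroup R) : Prop :=
  ∀ r : R, ∀ x ∈ I, x * r ∈ I

/-- `I` is a one-sided (left or right) ideal of `R`. -/
def IsOneSidedIdeal (R : Type*) [Ring R] (I : AddSubgroup R) : Prop :=
  IsLeftIdeal R I ∨ IsRightIdeal R I

/-- `IPO(R)`: the set of all products `I*J` of two one-sided ideals of `R`.
Here `I * J` is the additive subgroup generated by `{a*b : a ∈ I, b ∈ J}`
(the pointwise product of additive subgroups). -/
def IPO (R : Type*) [Ring R] : Set (AddSubgroup R) :=
  {A | ∃ I J : AddSubgroup R, IsOneSidedIdeal R I ∧ IsOneSidedIdeal R J ∧ A = I * J}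

/-- `A` is a vertex of `APOG(R) = Γ(IPO(R))`: a nonzero element of `IPO(R)` that is a
one-sided zero-divisor of the semigroup `IPO(R)`. -/
def APOGVertex (R : Type*) [Ring R] (A : AddSubgroup R) : Prop :=
  A ∈ IPO R ∧ A ≠ ⊥ ∧ ∃ B ∈ IPO R, B ≠ ⊥ ∧ (A * B = ⊥ ∨ B * A = ⊥)

/-- The directed edge `A → B` of `APOG(R)`: both are vertices, `A ≠ B` and `A*B = 0`. -/
def APOGEdge (R : Type*) [Ring R] (A B : AddSubgroup R) : Prop :=
  APOGVertex R A ∧ APOGVertex R B ∧ A ≠ B ∧ A * B = ⊥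

/-- The set of one-sided zero-divisors of the ring `R`. -/
def Dset (R : Type*) [Ring R] : Set R :=
  {x | ∃ y : R, y ≠ 0 ∧ (x * y = 0 ∨ y * x = 0)}

theorem apo_mem_mul {R : Type*} [Ring R] {A B : AddSubgroup R} {a b : R}
    (ha : a ∈ A) (hb : b ∈ B) : a * b ∈ A * B :=
  AddSubmonoid.mul_mem_mul (M := A.toAddSubmonoid) (N := B.toAddSubmonoid) ha hb

theorem apo_mul_le {R : Type*} [Ring R] {A B C : AddSubgroup R} :
    A * B ≤ C ↔ ∀ a ∈ A, ∀ b ∈ B, a * b ∈ C :=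
  AddSubmonoid.mul_le (M := A.toAddSubmonoid) (N := B.toAddSubmonoid) (P := C.toAddSubmonoid)

theorem apo_mul_bot {R : Type*} [Ring R] {A B : AddSubgroup R} :
    A * B = ⊥ ↔ ∀ a ∈ A, ∀ b ∈ B, a * b = 0 := by
  rw [eq_bot_iff, apo_mul_le]; simp [AddSubgroup.mem_bot]

theorem apo_ne_bot {R : Type*} [Ring R] {A : AddSubgroup R} :
    A ≠ ⊥ ↔ ∃ a ∈ A, a ≠ 0 := by
  rw [Ne, AddSubgroup.eq_bot_iff_forall]; push Not; rfl

theorem apo_left_mul_top {R : Type*} [Ring R] {A : AddSubgroup R} (h : IsLeftIdeal R A) :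
    A = ⊤ * A := by
  apply le_antisymm
  · intro a ha
    have := apo_mem_mul (AddSubgroup.mem_top (1 : R)) ha
    rwa [one_mul] at this
  · rw [apo_mul_le]; exact fun a _ b hb => h a b hb

theorem apo_right_mul_top {R : Type*} [Ring R] {A : AddSubgroup R} (h : IsRightIdeal R A) :
    A = A * ⊤ := by
  apply le_antisymm
  · intro a ha
    have := apo_mem_mul ha (AddSubgroup.mem_top (1 : R))
    rwa [mul_one] at this
  · rw [apo_mul_le]; exact fun a ha b _ => h b a ha

theorem apo_mem_IPO {R : Type*} [Ring R] {A : AddSubgroup R} (h : IsOneSidedIdeal R A) :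
    A ∈ IPO R := by
  have ht : IsOneSidedIdeal R (⊤ : AddSubgroup R) := Or.inl fun _ _ _ => AddSubgroup.mem_top _
  rcases h with h | h
  · exact ⟨⊤, A, ht, Or.inl h, apo_left_mul_top h⟩
  · exact ⟨A, ⊤, Or.inr h, ht, apo_right_mul_top h⟩

/-- The principal left ideal. -/
def apoL {R : Type*} [Ring R] (x : R) : AddSubgroup R := (AddMonoidHom.mulRight x).range

/-- The principal right ideal. -/
def apoR {R : Type*} [Ring R] (x : R) : AddSubgroup R := (AddMonoidHom.mulLeft x).range

theorem mem_apoL {R : Type*} [Ring R] {x y : R} : y ∈ apoL x ↔ ∃ r, r * x = y := by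
  simp [apoL, AddMonoidHom.mem_range]

theorem mem_apoR {R : Type*} [Ring R] {x y : R} : y ∈ apoR x ↔ ∃ r, x * r = y := by
  simp [apoR, AddMonoidHom.mem_range]

theorem self_apoL {R : Type*} [Ring R] (x : R) : x ∈ apoL x := mem_apoL.2 ⟨1, one_mul x⟩

theorem self_apoR {R : Type*} [Ring R] (x : R) : x ∈ apoR x := mem_apoR.2 ⟨1, mul_one x⟩

theorem left_apoL {R : Type*} [Ring R] (x : R) : IsLeftIdeal R (apoL x) := by
  intro r y hy
  obtain ⟨s, rfl⟩ := mem_apoL.1 hy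
  exact mem_apoL.2 ⟨r * s, mul_assoc _ _ _⟩

theorem right_apoR {R : Type*} [Ring R] (x : R) : IsRightIdeal R (apoR x) := by
  intro r y hy
  obtain ⟨s, rfl⟩ := mem_apoR.1 hy
  exact mem_apoR.2 ⟨s * r, (mul_assoc _ _ _).symm⟩

/-- One-sided ideals which are annihilated elementwise by some nonzero element. -/
def ApoP {R : Type*} [Ring R] (A : AddSubgroup R) : Prop :=
  IsOneSidedIdeal R A ∧ (∃ a ∈ A, a ≠ 0) ∧
    ∃ b : R, b ≠ 0 ∧ ((∀ a ∈ A, a * b = 0) ∨ (∀ a ∈ A, b * a = 0))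

/-- Elementwise completeness. -/
def ApoH (R : Type*) [Ring R] : Prop :=
  ∀ A B : AddSubgroup R, ApoP A → ApoP B → A ≠ B →
    (∀ a ∈ A, ∀ b ∈ B, a * b = 0) ∨ (∀ a ∈ A, ∀ b ∈ B, b * a = 0)

theorem ApoP.vertex {R : Type*} [Ring R] {A : AddSubgroup R} (h : ApoP A) : APOGVertex R A := by
  obtain ⟨hA, hne, b, hb, hab⟩ := h
  refine ⟨apo_mem_IPO hA, apo_ne_bot.2 hne, ?_⟩
  rcases hA with hA | hA
  · refine ⟨apoR b, apo_mem_IPO (Or.inr (right_apoR b)), apo_ne_bot.2 ⟨b, self_apoR b, hb⟩, ?_⟩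
    rcases hab with hab | hab
    · left
      rw [apo_mul_bot]
      intro a ha c hc
      obtain ⟨s, rfl⟩ := mem_apoR.1 hc
      rw [← mul_assoc, hab a ha, zero_mul]
    · right
      rw [apo_mul_bot]
      intro c hc a ha
      obtain ⟨s, rfl⟩ := mem_apoR.1 hc
      rw [mul_assoc, hab _ (hA s a ha)]
  · refine ⟨apoL b, apo_mem_IPO (Or.inl (left_apoL b)), apo_ne_bot.2 ⟨b, self_apoL b, hb⟩, ?_⟩
    rcases hab with hab | hab
    · left
      rw [apo_mul_bot]
      intro a ha c hc
      obtain ⟨s, rfl⟩ := mem_apoL.1 hc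
      rw [← mul_assoc, hab _ (hA s a ha)]
    · right
      rw [apo_mul_bot]
      intro c hc a ha
      obtain ⟨s, rfl⟩ := mem_apoL.1 hc
      rw [mul_assoc, hab a ha, mul_zero]

theorem apoH_of_complete {R : Type*} [Ring R]
    (h : ∀ A B : AddSubgroup R, APOGVertex R A → APOGVertex R B → A ≠ B →
        (A * B = ⊥ ∨ B * A = ⊥)) : ApoH R := by
  intro A B hA hB hne
  rcases h A B hA.vertex hB.vertex hne with h | h
  · exact Or.inl (apo_mul_bot.1 h)
  · exact Or.inr fun a ha b hb => apo_mul_bot.1 h b hb a ha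

/-- If both kinds of products are nonzero then the two ideals agree. -/
theorem ApoH.eq {R : Type*} [Ring R] (H : ApoH R) {A B : AddSubgroup R} (hA : ApoP A)
    (hB : ApoP B) {a b a' b' : R} (ha : a ∈ A) (hb : b ∈ B) (hab : a * b ≠ 0)
    (ha' : a' ∈ A) (hb' : b' ∈ B) (hba : b' * a' ≠ 0) : A = B := by
  by_contra hne
  rcases H A B hA hB hne with h | h
  · exact hab (h a ha b hb)
  · exact hba (h a' ha' b' hb')

theorem apoP_L {R : Type*} [Ring R] {x y : R} (hx : x ≠ 0) (hy : y ≠ 0) (h : x * y = 0) :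
    ApoP (apoL x) := by
  refine ⟨Or.inl (left_apoL x), ⟨x, self_apoL x, hx⟩, y, hy, Or.inl fun a ha => ?_⟩
  obtain ⟨s, rfl⟩ := mem_apoL.1 ha
  rw [mul_assoc, h, mul_zero]

theorem apoP_R {R : Type*} [Ring R] {x y : R} (hx : x ≠ 0) (hy : y ≠ 0) (h : y * x = 0) :
    ApoP (apoR x) := by
  refine ⟨Or.inr (right_apoR x), ⟨x, self_apoR x, hx⟩, y, hy, Or.inr fun a ha => ?_⟩
  obtain ⟨s, rfl⟩ := mem_apoR.1 ha
  rw [← mul_assoc, h, zero_mul]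

theorem apoP_mono {R : Type*} [Ring R] {A B : AddSubgroup R} (hB : IsOneSidedIdeal R B)
    (hA : ApoP A) (hBA : B ≤ A) (hne : ∃ b ∈ B, b ≠ 0) : ApoP B := by
  obtain ⟨_, _, b, hb, hab⟩ := hA
  refine ⟨hB, hne, b, hb, hab.imp (fun h a ha => h a (hBA ha)) (fun h a ha => h a (hBA ha))⟩

theorem apoP_of_Dset {R : Type*} [Ring R] {x : R} (hx : x ∈ Dset R) (h0 : x ≠ 0) :
    ∃ A : AddSubgroup R, ApoP A ∧ x ∈ A := by
  obtain ⟨y, hy, h | h⟩ := hx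
  · exact ⟨apoL x, apoP_L h0 hy h, self_apoL x⟩
  · exact ⟨apoR x, apoP_R h0 hy h, self_apoR x⟩

/-- A vertex with nonzero square. -/
theorem ApoH.exists_sq {R : Type*} [Ring R] (H : ApoH R) {x z : R} (hx : x ∈ Dset R)
    (hz : z ∈ Dset R) (hxz : x * z ≠ 0) :
    ∃ A : AddSubgroup R, ApoP A ∧ ∃ a ∈ A, ∃ b ∈ A, a * b ≠ 0 := by
  have hx0 : x ≠ 0 := left_ne_zero_of_mul hxz
  have hz0 : z ≠ 0 := right_ne_zero_of_mul hxz
  obtain ⟨A, hA, hxA⟩ := apoP_of_Dset hx hx0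
  obtain ⟨B, hB, hzB⟩ := apoP_of_Dset hz hz0
  by_cases hAB : A = B
  · subst hAB
    exact ⟨A, hA, x, hxA, z, hzB, hxz⟩
  · have hzx : z * x = 0 := by
      rcases H A B hA hB hAB with h | h
      · exact absurd (h x hxA z hzB) hxz
      · exact h x hxA z hzB
    by_cases hzz : z * z = 0
    · by_cases hxx : x * x = 0
      · have hs : (x + z) * (x + z) ≠ 0 := by
          rw [add_mul, mul_add, mul_add, hxx, hzx, hzz]; simpa using hxz
        refine ⟨apoL (x + z), apoP_L (left_ne_zero_of_mul hs) hxz ?_, _, self_apoL _, _,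
          self_apoL _, hs⟩
        rw [add_mul, ← mul_assoc, ← mul_assoc, hxx, hzx]; simp
      · exact ⟨apoR x, apoP_R hx0 hz0 hzx, x, self_apoR x, x, self_apoR x, hxx⟩
    · exact ⟨apoL z, apoP_L hz0 hx0 hzx, z, self_apoL z, z, self_apoL z, hzz⟩

theorem apo_two_sided {R : Type*} [Ring R] {A : AddSubgroup R} {a b : R} (ha : a ∈ A)
    (hb : b ∈ A) (hab : a * b ≠ 0) :
    ∃ x ∈ A, (∃ c ∈ A, x * c ≠ 0) ∧ ∃ c ∈ A, c * x ≠ 0 := by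
  by_cases h1 : ∃ c ∈ A, c * a ≠ 0
  · exact ⟨a, ha, ⟨b, hb, hab⟩, h1⟩
  by_cases h2 : ∃ c ∈ A, b * c ≠ 0
  · exact ⟨b, hb, h2, ⟨a, ha, hab⟩⟩
  push Not at h1 h2
  refine ⟨a + b, A.add_mem ha hb, ⟨b, hb, ?_⟩, ⟨a, ha, ?_⟩⟩
  · rw [add_mul, h2 b hb, add_zero]; exact hab
  · rw [mul_add, h1 a ha, zero_add]; exact hab

theorem apo_cube {R : Type*} [Ring R] (hid : ∀ e : R, e * e = e → e = 0 ∨ e = 1) {l : R}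
    (h : l * l * l = l * l) : l * l = 0 ∨ l * l = 1 := by
  apply hid
  rw [← mul_assoc, h, h]

theorem apoP_one {R : Type*} [Ring R] {A : AddSubgroup R} (hA : ApoP A) (h1 : (1 : R) ∈ A) :
    False := by
  obtain ⟨_, _, b, hb, h | h⟩ := hA
  · exact hb (by simpa using h 1 h1)
  · exact hb (by simpa using h 1 h1)

theorem ApoH.gen_left {R : Type*} [Ring R] (H : ApoH R)
    (hid : ∀ e : R, e * e = e → e = 0 ∨ e = 1) {A : AddSubgroup R} (hA : ApoP A)
    (hl : IsLeftIdeal R A) {a b : R} (ha : a ∈ A) (hb : b ∈ A) (hab : a * b ≠ 0) :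
    ∃ x : R, x * x ≠ 0 ∧ x * x * x = 0 ∧ apoL x = apoR x := by
  obtain ⟨x, hx, ⟨c, hc, hxc⟩, ⟨d, hd, hdx⟩⟩ := apo_two_sided ha hb hab
  have hx0 : x ≠ 0 := right_ne_zero_of_mul hdx
  have hsub : ∀ y ∈ A, apoL y ≤ A := by
    intro y hy z hz
    obtain ⟨s, rfl⟩ := mem_apoL.1 hz
    exact hl s y hy
  have hP : ∀ y ∈ A, y ≠ 0 → ApoP (apoL y) := fun y hy h0 =>
    apoP_mono (Or.inl (left_apoL y)) hA (hsub y hy) ⟨y, self_apoL y, h0⟩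
  have hxA : apoL x = A := H.eq (hP x hx hx0) hA (self_apoL x) hc hxc (self_apoL x) hd hdx
  have hxx : x * x ≠ 0 := by
    rw [← hxA] at hd
    obtain ⟨r, rfl⟩ := mem_apoL.1 hd
    rw [mul_assoc] at hdx
    exact right_ne_zero_of_mul hdx
  have hne : A ≠ apoL (x * x) := by
    intro he
    have hx' := hx
    rw [he] at hx'
    obtain ⟨r, hr⟩ := mem_apoL.1 hx'
    obtain ⟨l, rfl⟩ : ∃ l, l = r * x := ⟨_, rfl⟩
    generalize hle : r * x = l at *
    have hlx : l * x = x := by rw [← hle, mul_assoc, hr]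
    have hlA : l ∈ A := by rw [← hle]; exact hl r x hx
    have hkA : l * l - l ∈ A := A.sub_mem (hl l l hlA) hlA
    have hkx : (l * l - l) * x = 0 := by rw [sub_mul, mul_assoc, hlx, hlx, sub_self]
    have hlll : l * l * l = l * l := by
      by_cases hk : l * l - l = 0
      · rw [sub_eq_zero] at hk
        rw [hk, hk]
      · have hkne : apoL (l * l - l) ≠ A := by
          intro hh
          rw [← hh] at hx
          obtain ⟨s, hs⟩ := mem_apoL.1 hx
          apply hxx
          nth_rw 1 [← hs]
          rw [mul_assoc, hkx, mul_zero]
        rcases H _ _ (hP _ hkA hk) hA hkne with h | h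
        · have := h _ (self_apoL _) l hlA
          rwa [sub_mul, sub_eq_zero] at this
        · have := h _ (self_apoL _) l hlA
          rwa [mul_sub, sub_eq_zero, ← mul_assoc] at this
    have hllx : l * l * x = x := by rw [mul_assoc, hlx, hlx]
    rcases apo_cube hid hlll with h | h
    · rw [h, zero_mul] at hllx
      exact hx0 hllx.symm
    · exact apoP_one hA (h ▸ hl l l hlA)
  have hxxx : x * x * x = 0 := by
    rcases H _ _ hA (hP _ (hl x x hx) hxx) hne with h | h
    · rw [mul_assoc]; exact h x hx _ (self_apoL _)
    · exact h x hx _ (self_apoL _)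
  refine ⟨x, hxx, hxxx, ?_⟩
  exact H.eq (hP x hx hx0) (apoP_R hx0 hxx hxxx) (self_apoL x) (self_apoR x) hxx
    (self_apoL x) (self_apoR x) hxx

theorem ApoH.gen_right {R : Type*} [Ring R] (H : ApoH R)
    (hid : ∀ e : R, e * e = e → e = 0 ∨ e = 1) {A : AddSubgroup R} (hA : ApoP A)
    (hl : IsRightIdeal R A) {a b : R} (ha : a ∈ A) (hb : b ∈ A) (hab : a * b ≠ 0) :
    ∃ x : R, x * x ≠ 0 ∧ x * x * x = 0 ∧ apoL x = apoR x := by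
  obtain ⟨x, hx, ⟨c, hc, hxc⟩, ⟨d, hd, hdx⟩⟩ := apo_two_sided ha hb hab
  have hx0 : x ≠ 0 := right_ne_zero_of_mul hdx
  have hsub : ∀ y ∈ A, apoR y ≤ A := by
    intro y hy z hz
    obtain ⟨s, rfl⟩ := mem_apoR.1 hz
    exact hl s y hy
  have hP : ∀ y ∈ A, y ≠ 0 → ApoP (apoR y) := fun y hy h0 =>
    apoP_mono (Or.inr (right_apoR y)) hA (hsub y hy) ⟨y, self_apoR y, h0⟩
  have hxA : apoR x = A := H.eq (hP x hx hx0) hA (self_apoR x) hc hxc (self_apoR x) hd hdx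
  have hxx : x * x ≠ 0 := by
    rw [← hxA] at hc
    obtain ⟨r, rfl⟩ := mem_apoR.1 hc
    rw [← mul_assoc] at hxc
    exact left_ne_zero_of_mul hxc
  have hne : A ≠ apoR (x * x) := by
    intro he
    have hx' := hx
    rw [he] at hx'
    obtain ⟨r, hr⟩ := mem_apoR.1 hx'
    generalize hle : x * r = l at *
    have hlx : x * l = x := by rw [← hle, ← mul_assoc, hr]
    have hlA : l ∈ A := by rw [← hle]; exact hl r x hx
    have hkA : l * l - l ∈ A := A.sub_mem (hl l l hlA) hlA
    have hkx : x * (l * l - l) = 0 := by rw [mul_sub, ← mul_assoc, hlx, hlx, sub_self]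
    have hlll : l * l * l = l * l := by
      by_cases hk : l * l - l = 0
      · rw [sub_eq_zero] at hk
        rw [hk, hk]
      · have hkne : apoR (l * l - l) ≠ A := by
          intro hh
          rw [← hh] at hx
          obtain ⟨s, hs⟩ := mem_apoR.1 hx
          apply hxx
          nth_rw 2 [← hs]
          rw [← mul_assoc, hkx, zero_mul]
        rcases H _ _ (hP _ hkA hk) hA hkne with h | h
        · have := h _ (self_apoR _) l hlA
          rwa [sub_mul, sub_eq_zero] at this
        · have := h _ (self_apoR _) l hlA
          rwa [mul_sub, sub_eq_zero, ← mul_assoc] at this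
    have hllx : x * (l * l) = x := by rw [← mul_assoc, hlx, hlx]
    rcases apo_cube hid hlll with h | h
    · rw [h, mul_zero] at hllx
      exact hx0 hllx.symm
    · exact apoP_one hA (h ▸ hl l l hlA)
  have hxxx : x * x * x = 0 := by
    rcases H _ _ hA (hP _ (hl x x hx) hxx) hne with h | h
    · rw [mul_assoc]; exact h x hx _ (self_apoR _)
    · exact h x hx _ (self_apoR _)
  refine ⟨x, hxx, hxxx, ?_⟩
  exact H.eq (apoP_L hx0 hxx (by rw [← mul_assoc]; exact hxxx)) (hP x hx hx0)
    (self_apoL x) (self_apoR x) hxx (self_apoL x) (self_apoR x) hxx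

theorem ApoH.loc_ring {R : Type*} [Ring R] (H : ApoH R) {x : R} (hxx : x * x ≠ 0)
    (hxxx : x * x * x = 0) (hLR : apoL x = apoR x) :
    ∃ m : AddSubgroup R, IsLeftIdeal R m ∧ IsRightIdeal R m ∧
          (∀ x : R, x ∈ m ↔ ¬ IsUnit x) ∧
          IPO R = {(⊥ : AddSubgroup R), m, m * m, (⊤ : AddSubgroup R)} := by
  have hx0 : x ≠ 0 := left_ne_zero_of_mul hxx
  have hxxx' : x * (x * x) = 0 := by rw [← mul_assoc]; exact hxxx
  have hml : IsLeftIdeal R (apoL x) := left_apoL x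
  have hmr : IsRightIdeal R (apoL x) := by rw [hLR]; exact right_apoR x
  have hxm : x ∈ apoL x := self_apoL x
  have hPm : ApoP (apoL x) := apoP_L hx0 hxx hxxx'
  have mvr : ∀ r, ∃ s, r * x = x * s := fun r => by
    have : r * x ∈ apoR x := hLR ▸ mem_apoL.2 ⟨r, rfl⟩
    obtain ⟨s, hs⟩ := mem_apoR.1 this
    exact ⟨s, hs.symm⟩
  have mvl : ∀ r, ∃ s, x * r = s * x := fun r => by
    have : x * r ∈ apoL x := hLR ▸ mem_apoR.2 ⟨r, rfl⟩
    obtain ⟨s, hs⟩ := mem_apoL.1 this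
    exact ⟨s, hs.symm⟩
  have hlann : ∀ t, t * (x * x) = 0 → t ∈ apoL x := by
    intro t ht
    let A : AddSubgroup R := (AddMonoidHom.mulRight (x * x)).ker
    have hmem : ∀ a, a ∈ A ↔ a * (x * x) = 0 := fun a => by simp [A, AddMonoidHom.mem_ker]
    have hxA : x ∈ A := (hmem x).2 hxxx'
    have hPA : ApoP A := by
      refine ⟨Or.inl fun r a ha => ?_, ⟨x, hxA, hx0⟩, x * x, hxx, Or.inl fun a ha => (hmem a).1 ha⟩
      rw [hmem] at ha ⊢
      rw [mul_assoc, ha, mul_zero]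
    have : A = apoL x := H.eq hPA hPm hxA hxm hxx hxA hxm hxx
    rw [← this]; exact (hmem t).2 ht
  have hrann : ∀ t, (x * x) * t = 0 → t ∈ apoL x := by
    intro t ht
    let A : AddSubgroup R := (AddMonoidHom.mulLeft (x * x)).ker
    have hmem : ∀ a, a ∈ A ↔ (x * x) * a = 0 := fun a => by simp [A, AddMonoidHom.mem_ker]
    have hxA : x ∈ A := (hmem x).2 hxxx
    have hPA : ApoP A := by
      refine ⟨Or.inr fun r a ha => ?_, ⟨x, hxA, hx0⟩, x * x, hxx, Or.inr fun a ha => (hmem a).1 ha⟩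
      rw [hmem] at ha ⊢
      rw [← mul_assoc, ha, zero_mul]
    have : A = apoL x := H.eq hPA hPm hxA hxm hxx hxA hxm hxx
    rw [← this]; exact (hmem t).2 ht
  have hmx : ∀ a ∈ apoL x, a * (x * x) = 0 := by
    intro a ha
    obtain ⟨r, rfl⟩ := mem_apoL.1 ha
    rw [mul_assoc, hxxx', mul_zero]
  have hmmm : ∀ a ∈ apoL x, ∀ b ∈ apoL x, ∀ c ∈ apoL x, a * b * c = 0 := by
    intro a ha b hb c hc
    rw [hLR] at hc
    obtain ⟨t, rfl⟩ := mem_apoR.1 hc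
    obtain ⟨s, rfl⟩ := mem_apoL.1 hb
    calc a * (s * x) * (x * t) = (a * s) * (x * x) * t := by noncomm_ring
      _ = 0 := by rw [hmx _ (hmr s a ha), zero_mul]
  have h1m : (1 : R) ∉ apoL x := fun h => apoP_one hPm h
  have hunit1 : ∀ a ∈ apoL x, IsUnit (1 + a) := by
    intro a ha
    have : IsNilpotent a := ⟨3, by rw [pow_succ, pow_two]; exact hmmm a ha a ha a ha⟩
    exact this.isUnit_one_add
  have hleft : ∀ y, y ∉ apoL x → ∃ r, r * y = 1 := by
    intro y hy
    have hyxx : y * x * x ≠ 0 := fun h => hy (hlann y (by rw [← mul_assoc]; exact h))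
    have hyx : y * x ≠ 0 := left_ne_zero_of_mul hyxx
    have hxyx : x * (y * x) ≠ 0 := by
      intro h
      obtain ⟨s, hs⟩ := mvl y
      have h1 : s * (x * x) = 0 := by rw [← mul_assoc, ← hs, mul_assoc, h]
      have h2 := hlann s h1
      apply hy
      apply hrann
      rw [mul_assoc, hs, ← mul_assoc]
      exact hmmm x hxm s h2 x hxm
    have hyxm : y * x ∈ apoL x := mem_apoL.2 ⟨y, rfl⟩
    have hPy : ApoP (apoL (y * x)) := apoP_L hyx hxx (by rw [mul_assoc, hxxx', mul_zero])
    have heq : apoL (y * x) = apoL x :=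
      H.eq hPy hPm (self_apoL _) hxm hyxx (self_apoL _) hxm hxyx
    have : x ∈ apoL (y * x) := heq ▸ hxm
    obtain ⟨r, hr⟩ := mem_apoL.1 this
    have h3 : r * y - 1 ∈ apoL x := by
      apply hlann
      have : (r * y - 1) * (x * x) = (r * (y * x) - x) * x := by noncomm_ring
      rw [this, hr, sub_self, zero_mul]
    obtain ⟨u, hu⟩ := (hunit1 _ h3)
    rw [add_sub_cancel] at hu
    exact ⟨↑u⁻¹ * r, by rw [mul_assoc, ← hu, Units.inv_mul]⟩
  have hU : ∀ y, y ∉ apoL x → IsUnit y := by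
    intro y hy
    obtain ⟨r, hr⟩ := hleft y hy
    have hrm : r ∉ apoL x := fun h => h1m (hr ▸ hmr y r h)
    obtain ⟨s, hs⟩ := hleft r hrm
    have hsy : s = y := left_inv_eq_right_inv hs hr
    subst hsy
    exact ⟨⟨s, r, hs, hr⟩, rfl⟩
  have hmU : ∀ y, y ∈ apoL x ↔ ¬ IsUnit y := by
    intro y
    constructor
    · rintro h ⟨u, rfl⟩
      exact h1m (by simpa using hml (↑u⁻¹ : R) _ h)
    · intro h
      by_contra h'
      exact h (hU y h')
  have hxx2 : x * x ∈ apoL x * apoL x := apo_mem_mul hxm hxm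
  have hm2 : ∀ a, a ∈ apoL x * apoL x → ∃ r, a = r * (x * x) := by
    have : apoL x * apoL x ≤ apoL (x * x) := by
      rw [apo_mul_le]
      intro a ha b hb
      obtain ⟨r, rfl⟩ := mem_apoL.1 ha
      obtain ⟨s, rfl⟩ := mem_apoL.1 hb
      obtain ⟨t, ht⟩ := mvl s
      refine mem_apoL.2 ⟨r * t, ?_⟩
      calc r * t * (x * x) = r * (t * x) * x := by noncomm_ring
        _ = r * x * (s * x) := by rw [← ht]; noncomm_ring
    intro a ha
    obtain ⟨r, hr⟩ := mem_apoL.1 (this ha)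
    exact ⟨r, hr.symm⟩
  have hm2m : apoL x * apoL x ≤ apoL x := by
    rw [apo_mul_le]
    exact fun a _ b hb => hml a b hb
  have hm2l : IsLeftIdeal R (apoL x * apoL x) := by
    intro r a ha
    obtain ⟨s, rfl⟩ := hm2 a ha
    have := apo_mem_mul (hml (r * s) x hxm) hxm
    rwa [mul_assoc, mul_assoc] at this
  have hm2r : IsRightIdeal R (apoL x * apoL x) := by
    intro r a ha
    obtain ⟨s, rfl⟩ := hm2 a ha
    have := apo_mem_mul (hml s x hxm) (hmr r x hxm)
    have h' : s * (x * x) * r = s * x * (x * r) := by noncomm_ring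
    rwa [h']
  have hclass : ∀ A : AddSubgroup R, IsOneSidedIdeal R A →
      A = ⊥ ∨ A = apoL x ∨ A = apoL x * apoL x ∨ A = ⊤ := by
    intro A hA
    by_cases h1 : ∃ a ∈ A, a ∉ apoL x
    · obtain ⟨a, ha, ham⟩ := h1
      obtain ⟨u, rfl⟩ := hU a ham
      right; right; right
      rw [eq_top_iff]
      intro y _
      rcases hA with hA | hA
      · simpa using hA (y * ↑u⁻¹) _ ha
      · simpa using hA (↑u⁻¹ * y) _ ha
    push Not at h1
    by_cases h2 : ∃ a ∈ A, a ∉ apoL x * apoL x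
    · obtain ⟨a, ha, ham⟩ := h2
      right; left
      apply le_antisymm h1
      rcases hA with hA | hA
      · obtain ⟨r, rfl⟩ := mem_apoL.1 (h1 a ha)
        have hr : r ∉ apoL x := fun h => ham (apo_mem_mul h hxm)
        obtain ⟨s, hs⟩ := hleft r hr
        have hxA : x ∈ A := by
          have := hA s _ ha
          rwa [← mul_assoc, hs, one_mul] at this
        intro y hy
        obtain ⟨t, rfl⟩ := mem_apoL.1 hy
        exact hA t x hxA
      · have ha1 := h1 a ha
        rw [hLR] at ha1
        obtain ⟨r, rfl⟩ := mem_apoR.1 ha1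
        have hr : r ∉ apoL x := fun h => ham (apo_mem_mul hxm h)
        obtain ⟨u, rfl⟩ := hU r hr
        have hxA : x ∈ A := by simpa using hA (↑u⁻¹ : R) _ ha
        intro y hy
        rw [hLR] at hy
        obtain ⟨t, rfl⟩ := mem_apoR.1 hy
        exact hA t x hxA
    push Not at h2
    by_cases h3 : ∃ a ∈ A, a ≠ 0
    · obtain ⟨a, ha, ha0⟩ := h3
      right; right; left
      apply le_antisymm h2
      obtain ⟨r, rfl⟩ := hm2 a (h2 a ha)
      rcases hA with hA | hA
      · have hr : r ∉ apoL x := fun h => ha0 (hmx r h)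
        obtain ⟨s, hs⟩ := hleft r hr
        have hxA : x * x ∈ A := by
          have := hA s _ ha
          rwa [← mul_assoc, hs, one_mul] at this
        intro y hy
        obtain ⟨t, rfl⟩ := hm2 y hy
        exact hA t _ hxA
      · obtain ⟨t, ht⟩ := mvr r
        obtain ⟨t', ht'⟩ := mvr t
        have hrt : r * (x * x) = x * x * t' := by
          rw [← mul_assoc, ht, mul_assoc, ht', ← mul_assoc]
        rw [hrt] at ha ha0
        have hr : t' ∉ apoL x := fun h => ha0 (hmmm x hxm x hxm t' h)
        obtain ⟨u, rfl⟩ := hU t' hr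
        have hxA : x * x ∈ A := by simpa using hA (↑u⁻¹ : R) _ ha
        intro y hy
        obtain ⟨w, rfl⟩ := hm2 y hy
        obtain ⟨v, hv⟩ := mvr w
        obtain ⟨v', hv'⟩ := mvr v
        have hwv : w * (x * x) = x * x * v' := by
          rw [← mul_assoc, hv, mul_assoc, hv', ← mul_assoc]
        rw [hwv]
        exact hA v' _ hxA
    · left
      push Not at h3
      exact (AddSubgroup.eq_bot_iff_forall A).2 h3
  refine ⟨apoL x, hml, hmr, hmU, ?_⟩
  have two : ∀ A : AddSubgroup R, IsOneSidedIdeal R A → IsLeftIdeal R A := by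
    intro A hA
    rcases hclass A hA with rfl | rfl | rfl | rfl
    · intro r y hy
      rw [AddSubgroup.mem_bot] at hy ⊢
      rw [hy, mul_zero]
    · exact hml
    · exact hm2l
    · exact fun _ _ _ => AddSubgroup.mem_top _
  ext A
  simp only [Set.mem_insert_iff, Set.mem_singleton_iff]
  constructor
  · rintro ⟨I, J, hI, hJ, rfl⟩
    apply hclass
    left
    intro r y hy
    have key : I * J ≤ (I * J).comap (AddMonoidHom.mulLeft r) := by
      rw [apo_mul_le]
      intro a ha b hb
      rw [AddSubgroup.mem_comap, AddMonoidHom.coe_mulLeft, ← mul_assoc]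
      exact apo_mem_mul (two I hI r a ha) hb
    exact key hy
  · rintro (rfl | rfl | rfl | rfl)
    · exact apo_mem_IPO (Or.inl fun r y hy => by
        rw [AddSubgroup.mem_bot] at hy ⊢
        rw [hy, mul_zero])
    · exact apo_mem_IPO (Or.inl hml)
    · exact apo_mem_IPO (Or.inl hm2l)
    · exact apo_mem_IPO (Or.inl fun _ _ _ => AddSubgroup.mem_top _)

theorem ApoH.central {R : Type*} [Ring R] (H : ApoH R) {e : R} (he : e * e = e) (h0 : e ≠ 0)
    (h1 : e ≠ 1) : ∀ r, e * r = r * e := by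
  have hf : 1 - e ≠ 0 := fun h => h1 (sub_eq_zero.1 h).symm
  have hee : e * e ≠ 0 := by rwa [he]
  have hLR : apoL e = apoR e :=
    H.eq (apoP_L h0 hf (by rw [mul_sub, mul_one, he, sub_self]))
      (apoP_R h0 hf (by rw [sub_mul, one_mul, he, sub_self]))
      (self_apoL e) (self_apoR e) hee (self_apoL e) (self_apoR e) hee
  intro r
  have a1 : e * r ∈ apoL e := hLR ▸ mem_apoR.2 ⟨r, rfl⟩
  have a2 : r * e ∈ apoR e := hLR ▸ mem_apoL.2 ⟨r, rfl⟩
  obtain ⟨s, hs⟩ := mem_apoL.1 a1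
  obtain ⟨t, ht⟩ := mem_apoR.1 a2
  have b1 : e * r * e = e * r := by rw [← hs, mul_assoc, he]
  have b2 : e * (r * e) = r * e := by rw [← ht, ← mul_assoc, he]
  rw [← b1, mul_assoc, b2]

theorem ApoH.corner {R : Type*} [Ring R] (H : ApoH R) {e : R} (he : e * e = e) (h0 : e ≠ 0)
    (h1 : e ≠ 1) {a : R} (ha : a ≠ 0) (hea : e * a = a) (hae : a * e = a) :
    (∃ r, r * a = e) ∧ ∃ r, a * r = e := by
  have hf : 1 - e ≠ 0 := fun h => h1 (sub_eq_zero.1 h).symm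
  have hPe : ApoP (apoL e) := apoP_L h0 hf (by rw [mul_sub, mul_one, he, sub_self])
  have hPa : ApoP (apoL a) := apoP_L ha hf (by rw [mul_sub, mul_one, hae, sub_self])
  have hPa' : ApoP (apoR a) := apoP_R ha hf (by rw [sub_mul, one_mul, hea, sub_self])
  have h2 : apoL a = apoL e := H.eq hPa hPe (self_apoL a) (self_apoL e) (by rwa [hae])
    (self_apoL a) (self_apoL e) (by rwa [hea])
  have h3 : apoR a = apoL e := H.eq hPa' hPe (self_apoR a) (self_apoL e) (by rwa [hae])
    (self_apoR a) (self_apoL e) (by rwa [hea])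
  exact ⟨mem_apoL.1 (h2 ▸ self_apoL e), mem_apoR.1 (h3 ▸ self_apoL e)⟩

theorem ApoH.corner_unit {R : Type*} [Ring R] (H : ApoH R) {e : R} (he : IsIdempotentElem e)
    (h0 : e ≠ 0) (h1 : e ≠ 1) (a : he.Corner) : IsUnit a ∨ a = 0 := by
  by_cases ha : a = 0
  · exact Or.inr ha
  left
  obtain ⟨hea, hae⟩ := (Subsemigroup.mem_corner_iff he).1 a.2
  have ha' : a.1 ≠ 0 := fun h => ha (Subtype.ext h)
  obtain ⟨⟨r, hr⟩, ⟨s, hs⟩⟩ := H.corner he.eq h0 h1 ha' hea hae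
  let r' : he.Corner := ⟨e * r * e, r, rfl⟩
  let s' : he.Corner := ⟨e * s * e, s, rfl⟩
  have hr' : r' * a = 1 := Subtype.ext (by
    change e * r * e * a.1 = e
    rw [mul_assoc, hea, mul_assoc, hr, he.eq])
  have hs' : a * s' = 1 := Subtype.ext (by
    change a.1 * (e * s * e) = e
    rw [← mul_assoc, ← mul_assoc, hae, hs, he.eq])
  have : r' = s' := left_inv_eq_right_inv hr' hs'
  exact ⟨⟨a, r', this ▸ hs', hr'⟩, rfl⟩

theorem ApoH.prod {R : Type u} [Ring R] (H : ApoH R) {e : R} (he : IsIdempotentElem e)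
    (h0 : e ≠ 0) (h1 : e ≠ 1) :
    ∃ (D₁ D₂ : Type u) (i₁ : DivisionRing D₁) (i₂ : DivisionRing D₂),
          by letI := i₁; letI := i₂; exact Nonempty (R ≃+* D₁ × D₂) := by
  have hf : IsIdempotentElem (1 - e) := he.one_sub
  have hf0 : 1 - e ≠ 0 := fun h => h1 (sub_eq_zero.1 h).symm
  have hf1 : 1 - e ≠ 1 := fun h => h0 (by simpa using h)
  have hce : ∀ r, e * r = r * e := H.central he.eq h0 h1
  have hcf : ∀ r, (1 - e) * r = r * (1 - e) := H.central hf.eq hf0 hf1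
  have : Nontrivial he.Corner := ⟨⟨1, 0, fun h => h0 (congrArg Subtype.val h)⟩⟩
  have : Nontrivial hf.Corner := ⟨⟨1, 0, fun h => hf0 (congrArg Subtype.val h)⟩⟩
  have hc := CompleteOrthogonalIdempotents.of_isIdempotentElem he
  have φ := hc.ringEquivOfIsMulCentral (by
    intro i
    apply Semigroup.mem_center_iff.2
    fin_cases i
    · exact fun r => (hce r).symm
    · exact fun r => (hcf r).symm)
  refine ⟨he.Corner, hf.Corner, DivisionRing.ofIsUnitOrEqZero (H.corner_unit he h0 h1),
    DivisionRing.ofIsUnitOrEqZero (H.corner_unit hf hf0 hf1), ⟨?_⟩⟩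
  exact φ.trans (RingEquiv.piFinTwo fun i => (hc.idem i).Corner)

theorem apo_vertex_Dset {R : Type*} [Ring R] {A : AddSubgroup R} (h : APOGVertex R A) :
    ∀ a ∈ A, a ∈ Dset R := by
  obtain ⟨_, _, B, _, hB, hAB⟩ := h
  obtain ⟨b, hb, hb0⟩ := apo_ne_bot.1 hB
  intro a ha
  exact ⟨b, hb0, hAB.imp (fun h => apo_mul_bot.1 h a ha b hb) (fun h => apo_mul_bot.1 h b hb a ha)⟩

theorem apo_vertex_one {R : Type*} [Ring R] {A : AddSubgroup R} (h : APOGVertex R A) :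
    (1 : R) ∉ A := by
  intro h1
  obtain ⟨y, hy, h | h⟩ := apo_vertex_Dset h 1 h1
  · exact hy (by simpa using h)
  · exact hy (by simpa using h)

theorem apo_prod_left {R : Type*} [Ring R] {D₁ D₂ : Type*} [DivisionRing D₁] [DivisionRing D₂]
    (φ : R ≃+* D₁ × D₂) {A : AddSubgroup R} (hA : IsOneSidedIdeal R A) : IsLeftIdeal R A := by
  rcases hA with hA | hA
  · exact hA
  intro r x hx
  have : r * x = x * φ.symm ((φ x)⁻¹.1 * (φ r).1 * (φ x).1, (φ x)⁻¹.2 * (φ r).2 * (φ x).2) := by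
    apply φ.injective
    rw [map_mul, map_mul, RingEquiv.apply_symm_apply]
    ext
    · by_cases h : (φ x).1 = 0
      · simp [h]
      · simp [mul_assoc, mul_inv_cancel_left₀ h]
    · by_cases h : (φ x).2 = 0
      · simp [h]
      · simp [mul_assoc, mul_inv_cancel_left₀ h]
  rw [this]
  exact hA _ x hx

theorem apo_prod_IPO {R : Type*} [Ring R] {D₁ D₂ : Type*} [DivisionRing D₁] [DivisionRing D₂]
    (φ : R ≃+* D₁ × D₂) {A : AddSubgroup R} (hA : A ∈ IPO R) : IsLeftIdeal R A := by
  obtain ⟨I, J, hI, hJ, rfl⟩ := hA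
  intro r y hy
  have key : I * J ≤ (I * J).comap (AddMonoidHom.mulLeft r) := by
    rw [apo_mul_le]
    intro a ha b hb
    rw [AddSubgroup.mem_comap, AddMonoidHom.coe_mulLeft, ← mul_assoc]
    exact apo_mem_mul (apo_prod_left φ hI r a ha) hb
  exact key hy

theorem apo_prod_vertex {R : Type*} [Ring R] {D₁ D₂ : Type*} [DivisionRing D₁] [DivisionRing D₂]
    (φ : R ≃+* D₁ × D₂) {A : AddSubgroup R} (hA : APOGVertex R A) :
    (∀ a, a ∈ A ↔ (φ a).1 = 0) ∨ (∀ a, a ∈ A ↔ (φ a).2 = 0) := by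
  have hl := apo_prod_IPO φ hA.1
  have h1 := apo_vertex_one hA
  obtain ⟨a, ha, ha0⟩ := apo_ne_bot.1 hA.2.1
  have e1 : ∀ b ∈ A, (φ b).1 ≠ 0 → φ.symm (1, 0) ∈ A := by
    intro b hb h
    have : φ.symm (1, 0) = φ.symm ((φ b).1⁻¹, 0) * b := by
      apply φ.injective
      rw [map_mul, RingEquiv.apply_symm_apply, RingEquiv.apply_symm_apply]
      ext <;> simp [h]
    rw [this]; exact hl _ b hb
  have e2 : ∀ b ∈ A, (φ b).2 ≠ 0 → φ.symm (0, 1) ∈ A := by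
    intro b hb h
    have : φ.symm (0, 1) = φ.symm (0, (φ b).2⁻¹) * b := by
      apply φ.injective
      rw [map_mul, RingEquiv.apply_symm_apply, RingEquiv.apply_symm_apply]
      ext <;> simp [h]
    rw [this]; exact hl _ b hb
  have hno : ¬ (φ.symm (1, 0) ∈ A ∧ φ.symm (0, 1) ∈ A) := by
    rintro ⟨ha, hb⟩
    apply h1
    have := A.add_mem ha hb
    rw [← map_add] at this
    have h11 : ((1, 0) : D₁ × D₂) + (0, 1) = 1 := by ext <;> simp
    rwa [h11, map_one] at this
  by_cases h : (φ a).1 = 0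
  · left
    have h2 : (φ a).2 ≠ 0 := fun h' => ha0 (φ.injective (by rw [map_zero]; ext <;> simp [h, h']))
    have hf := e2 a ha h2
    intro b
    constructor
    · intro hb
      by_contra hb1
      exact hno ⟨e1 b hb hb1, hf⟩
    · intro hb
      have : b = b * φ.symm (0, 1) := by
        apply φ.injective
        rw [map_mul, RingEquiv.apply_symm_apply]
        ext <;> simp [hb]
      rw [this]; exact hl _ _ hf
  · right
    have hf := e1 a ha h
    intro b
    constructor
    · intro hb
      by_contra hb1
      exact hno ⟨hf, e2 b hb hb1⟩
    · intro hb
      have : b = b * φ.symm (1, 0) := by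
        apply φ.injective
        rw [map_mul, RingEquiv.apply_symm_apply]
        ext <;> simp [hb]
      rw [this]; exact hl _ _ hf

theorem apo_prod_complete {R : Type*} [Ring R] {D₁ D₂ : Type*} [DivisionRing D₁] [DivisionRing D₂]
    (φ : R ≃+* D₁ × D₂) {A B : AddSubgroup R} (hA : APOGVertex R A) (hB : APOGVertex R B)
    (hne : A ≠ B) : A * B = ⊥ := by
  rw [apo_mul_bot]
  intro a ha b hb
  apply φ.injective
  rw [map_mul, map_zero]
  rcases apo_prod_vertex φ hA with h | h <;> rcases apo_prod_vertex φ hB with h' | h'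
  · exact absurd (AddSubgroup.ext fun x => (h x).trans (h' x).symm) hne
  · have h1 := (h a).1 ha
    have h2 := (h' b).1 hb
    ext <;> simp [h1, h2]
  · have h1 := (h a).1 ha
    have h2 := (h' b).1 hb
    ext <;> simp [h1, h2]
  · exact absurd (AddSubgroup.ext fun x => (h x).trans (h' x).symm) hne

theorem apo_local_vertex {R : Type*} [Ring R] {m : AddSubgroup R}
    (hI : IPO R = {(⊥ : AddSubgroup R), m, m * m, (⊤ : AddSubgroup R)})
    {A : AddSubgroup R} (hA : APOGVertex R A) : A = m ∨ A = m * m := by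
  have h := hA.1
  rw [hI] at h
  rcases h with h | h | h | h
  · exact absurd h hA.2.1
  · exact Or.inl h
  · exact Or.inr h
  · exact absurd (by rw [Set.mem_singleton_iff.1 h]; exact AddSubgroup.mem_top _) (apo_vertex_one hA)

theorem apo_local_complete {R : Type*} [Ring R] {m : AddSubgroup R}
    (hI : IPO R = {(⊥ : AddSubgroup R), m, m * m, (⊤ : AddSubgroup R)})
    (hm : APOGVertex R m) (hmm : m * m ≠ ⊥) : m * (m * m) = ⊥ ∧ m * m * m = ⊥ := by
  have hassoc : m * m * m = m * (m * m) := by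
    apply AddSubgroup.toAddSubmonoid_injective
    simp only [AddSubgroup.mul_toAddSubmonoid]
    exact mul_assoc _ _ _
  rw [hassoc, and_self]
  obtain ⟨_, hm0, B, hB, hB0, hmB⟩ := hm
  rw [hI] at hB
  rcases hB with rfl | rfl | rfl | h
  · exact absurd rfl hB0
  · exact absurd (or_self_iff.1 hmB) hmm
  · rw [hassoc, or_self] at hmB; exact hmB
  · rw [Set.mem_singleton_iff.1 h] at hmB
    exfalso
    obtain ⟨a, ha, ha0⟩ := apo_ne_bot.1 hm0
    rcases hmB with h | h
    · exact ha0 (by simpa using apo_mul_bot.1 h a ha 1 (AddSubgroup.mem_top _))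
    · exact ha0 (by simpa using apo_mul_bot.1 h 1 (AddSubgroup.mem_top _) a ha)

/-- `APOḠ(R)` is a complete graph iff `(D(R))² = 0`, or `R` is a
direct product of two division rings, or `R` is a local ring (the nonunits form a
two-sided ideal `m`) with `IPO(R) = {0, m, m², R}`. -/
theorem apog_complete_iff (R : Type u) [Ring R] :
    (∀ A B : AddSubgroup R, APOGVertex R A → APOGVertex R B → A ≠ B →
        (A * B = ⊥ ∨ B * A = ⊥)) ↔
      ((∀ x ∈ Dset R, ∀ y ∈ Dset R, x * y = 0) ∨
        (∃ (D₁ D₂ : Type u) (i₁ : DivisionRing D₁) (i₂ : DivisionRing D₂),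
          by letI := i₁; letI := i₂; exact Nonempty (R ≃+* D₁ × D₂)) ∨
        (∃ m : AddSubgroup R, IsLeftIdeal R m ∧ IsRightIdeal R m ∧
          (∀ x : R, x ∈ m ↔ ¬ IsUnit x) ∧
          IPO R = {(⊥ : AddSubgroup R), m, m * m, (⊤ : AddSubgroup R)})) := by
  constructor
  · intro h
    have H := apoH_of_complete h
    by_cases hi : ∀ x ∈ Dset R, ∀ y ∈ Dset R, x * y = 0
    · exact Or.inl hi
    right
    by_cases hid : ∀ e : R, e * e = e → e = 0 ∨ e = 1
    · right
      push Not at hi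
      obtain ⟨x, hx, z, hz, hxz⟩ := hi
      obtain ⟨A, hA, a, ha, b, hb, hab⟩ := H.exists_sq hx hz hxz
      obtain ⟨y, h1, h2, h3⟩ : ∃ x : R, x * x ≠ 0 ∧ x * x * x = 0 ∧ apoL x = apoR x := by
        rcases hA.1 with hl | hl
        · exact H.gen_left hid hA hl ha hb hab
        · exact H.gen_right hid hA hl ha hb hab
      exact H.loc_ring h1 h2 h3
    · left
      push Not at hid
      obtain ⟨e, he, h0, h1⟩ := hid
      exact H.prod he h0 h1
  · rintro (h | ⟨D₁, D₂, i₁, i₂, ⟨φ⟩⟩ | ⟨m, hl, hr, hu, hI⟩) A B hA hB hne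
    · left
      rw [apo_mul_bot]
      exact fun a ha b hb => h a (apo_vertex_Dset hA a ha) b (apo_vertex_Dset hB b hb)
    · exact Or.inl (apo_prod_complete φ hA hB hne)
    · rcases apo_local_vertex hI hA with rfl | rfl <;> rcases apo_local_vertex hI hB with rfl | rfl
      · exact absurd rfl hne
      · exact Or.inl (apo_local_complete hI hA hB.2.1).1
      · exact Or.inl (apo_local_complete hI hB hA.2.1).2
      · exact absurd rfl hne
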